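/- Let n ≥ 3 and let Ω ⊂ ℝⁿ be a bounded open set whose boundary ∂Ω is Ahlfors regular with constants C₁, C₂. Fix φ ∈ C_c^∞(ℝⁿ) with 0 ≤ φ ≤ 1, φ ≡ 1 on B(0,1/2) and supp φ ⊂ B(0,1), set φ_ε(z) = ε^{1−n} φ(z/ε), and for a measurable f : ∂Ω → [0,1] define f_ε(x) = (∫_{∂Ω} f(y) φ_ε(x − y) dσ(y)) / (∫_{∂Ω} φ_ε(x − y) dσ(y)) for x ∈ ∂Ω. Let E ⊂ ∂Ω be a Borel set, let δ₀ > 0, and set f(x) = max{0, 1 + δ₀ log M_σχ_E(x)}. Then for every x ∈ ∂Ω, f(x) ≤ liminf_{ε → 0⁺} f_ε(x). -/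

import Mathlib

open MeasureTheory Metric Set Filter Bornology
open scoped ENNReal NNReal Topology

noncomputable section

abbrev En (n : ℕ) : Type := EuclideanSpace ℝ (Fin n)

def AhlforsRegular (n : ℕ) (Ω : Set (En n)) (C₁ C₂ : ℝ) : Prop :=
  ∀ Q ∈ frontier Ω, ∀ r : ℝ, 0 < r → r ≤ diam Ω →
    ENNReal.ofReal (C₁ * r ^ (n - 1)) ≤ μH[(n : ℝ) - 1] (ball Q r ∩ frontier Ω) ∧
      μH[(n : ℝ) - 1] (ball Q r ∩ frontier Ω) ≤ ENNReal.ofReal (C₂ * r ^ (n - 1))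

/-- The normalized boundary mollification `f_ε` of `f` by `φ_ε(z) = ε^{1-n} φ(z/ε)`. -/
def mollify (n : ℕ) (Ω : Set (En n)) (φ : En n → ℝ) (ε : ℝ) (f : En n → ℝ)
    (x : En n) : ℝ :=
  (∫ y in frontier Ω, f y * ((ε ^ (n - 1))⁻¹ * φ (ε⁻¹ • (x - y))) ∂μH[(n : ℝ) - 1]) /
    ∫ y in frontier Ω, (ε ^ (n - 1))⁻¹ * φ (ε⁻¹ • (x - y)) ∂μH[(n : ℝ) - 1]

/-- The Hardy–Littlewood maximal function of `χ_E` with respect to `σ = H^{n-1}|_{∂Ω}`: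
`M_σχ_E(x) = sup { σ(E ∩ Δ)/σ(Δ) : Δ = Δ(Q,s) a surface ball containing x }`. -/
def maxFn (n : ℕ) (Ω : Set (En n)) (E : Set (En n)) (x : En n) : ℝ :=
  sSup {v : ℝ | ∃ Q ∈ frontier Ω, ∃ s : ℝ, 0 < s ∧ x ∈ ball Q s ∧
    v = (μH[(n : ℝ) - 1] (E ∩ (ball Q s ∩ frontier Ω))).toReal /
      (μH[(n : ℝ) - 1] (ball Q s ∩ frontier Ω)).toReal}

theorem aux_diam (n : ℕ) (hn : 3 ≤ n) (Ω : Set (En n)) (hΩ : IsOpen Ω) (hb : IsBounded Ω)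
    (hne : (frontier Ω).Nonempty) : 0 < diam Ω := by
  obtain ⟨x, hx⟩ := hne
  have hO : Ω.Nonempty := by
    rw [← closure_nonempty_iff]; exact ⟨x, frontier_subset_closure hx⟩
  obtain ⟨a, ha⟩ := hO
  haveI : Nonempty (Fin n) := ⟨⟨0, by omega⟩⟩
  have hnt : Ω.Nontrivial := by
    by_contra h
    rw [Set.not_nontrivial_iff] at h
    have h1 : Ω = {a} := h.eq_singleton_of_mem ha
    rw [h1] at hΩ
    exact not_isOpen_singleton a hΩ
  obtain ⟨b, hb1, c, hc, hbc⟩ := hnt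
  exact (dist_pos.2 hbc).trans_le (dist_le_diam_of_mem hb hb1 hc)

theorem aux_fin (n : ℕ) (hn : 3 ≤ n) (C₁ C₂ : ℝ) (Ω : Set (En n)) (hΩ : IsOpen Ω)
    (hb : IsBounded Ω) (hA : AhlforsRegular n Ω C₁ C₂) : μH[(n : ℝ) - 1] (frontier Ω) < ∞ := by
  rcases (frontier Ω).eq_empty_or_nonempty with h | hne
  · simp [h]
  have hd := aux_diam n hn Ω hΩ hb hne
  have hK : IsCompact (frontier Ω) :=
    isCompact_of_isClosed_isBounded isClosed_frontier
      (hb.closure.subset frontier_subset_closure)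
  obtain ⟨t, ht, hsub⟩ := hK.elim_nhds_subcover (fun x => ball x (diam Ω))
    (fun x _ => ball_mem_nhds x hd)
  have : frontier Ω ⊆ ⋃ x ∈ t, (ball x (diam Ω) ∩ frontier Ω) := by
    intro y hy
    have := hsub hy
    simp only [mem_iUnion] at this ⊢
    obtain ⟨i, hi, h⟩ := this
    exact ⟨i, hi, h, hy⟩
  refine (measure_mono this).trans_lt ?_
  refine (measure_biUnion_finset_le _ _).trans_lt ?_
  refine ENNReal.sum_lt_top.2 fun i hi => ?_
  exact ((hA i (ht i hi) _ hd le_rfl).2).trans_lt ENNReal.ofReal_lt_top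

theorem aux_pos (n : ℕ) (hn : 3 ≤ n) (C₁ C₂ : ℝ) (hC₁ : 0 < C₁) (Ω : Set (En n)) (hΩ : IsOpen Ω)
    (hb : IsBounded Ω) (hA : AhlforsRegular n Ω C₁ C₂) (x : En n) (hx : x ∈ frontier Ω)
    (r : ℝ) (hr : 0 < r) : 0 < μH[(n : ℝ) - 1] (ball x r ∩ frontier Ω) := by
  have hd := aux_diam n hn Ω hΩ hb ⟨x, hx⟩
  have hm : 0 < min r (diam Ω) := lt_min hr hd
  have h1 := (hA x hx _ hm (min_le_right _ _)).1
  refine lt_of_lt_of_le (lt_of_lt_of_le ?_ h1) (measure_mono ?_)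
  · exact ENNReal.ofReal_pos.2 (by positivity)
  · exact inter_subset_inter_left _ (ball_subset_ball (min_le_left _ _))

def mset (n : ℕ) (Ω : Set (En n)) (E : Set (En n)) (x : En n) : Set ℝ :=
  {v : ℝ | ∃ Q ∈ frontier Ω, ∃ s : ℝ, 0 < s ∧ x ∈ ball Q s ∧
    v = (μH[(n : ℝ) - 1] (E ∩ (ball Q s ∩ frontier Ω))).toReal /
      (μH[(n : ℝ) - 1] (ball Q s ∩ frontier Ω)).toReal}

theorem mset_le (n : ℕ) (Ω E : Set (En n)) (hfin : μH[(n : ℝ) - 1] (frontier Ω) < ∞) (x : En n) :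
    ∀ v ∈ mset n Ω E x, v ≤ 1 := by
  rintro v ⟨Q, hQ, s, hs, hx, rfl⟩
  refine div_le_one_of_le₀ ?_ ENNReal.toReal_nonneg
  exact ENNReal.toReal_mono ((measure_mono inter_subset_right).trans_lt hfin).ne
    (measure_mono inter_subset_right)

theorem mset_ne (n : ℕ) (Ω E : Set (En n)) (hne : (frontier Ω).Nonempty) (x : En n) :
    (mset n Ω E x).Nonempty := by
  obtain ⟨Q, hQ⟩ := hne
  exact ⟨_, Q, hQ, dist x Q + 1, by positivity, by simp, rfl⟩

theorem maxFn_lsc (n : ℕ) (Ω E : Set (En n)) (hfin : μH[(n : ℝ) - 1] (frontier Ω) < ∞)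
    (hne : (frontier Ω).Nonempty) : LowerSemicontinuous (maxFn n Ω E) := by
  intro x t ht
  obtain ⟨v, ⟨Q, hQ, s, hs, hx, hv⟩, htv⟩ := exists_lt_of_lt_csSup (mset_ne n Ω E hne x) ht
  filter_upwards [isOpen_ball.mem_nhds hx] with y hy
  exact htv.trans_le (le_csSup ⟨1, fun w hw => mset_le n Ω E hfin y w hw⟩ ⟨Q, hQ, s, hs, hy, hv⟩)

theorem maxFn_le (n : ℕ) (Ω E : Set (En n)) (hfin : μH[(n : ℝ) - 1] (frontier Ω) < ∞)
    (hne : (frontier Ω).Nonempty) (x : En n) : maxFn n Ω E x ≤ 1 :=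
  csSup_le (mset_ne n Ω E hne x) (mset_le n Ω E hfin x)

theorem maxFn_zero (n : ℕ) (Ω E : Set (En n))
    (hne : (frontier Ω).Nonempty) (h0 : μH[(n : ℝ) - 1] E = 0) (x : En n) :
    maxFn n Ω E x = 0 := by
  have : mset n Ω E x = {0} := by
    refine (mset_ne n Ω E hne x).subset_singleton_iff.1 ?_
    rintro v ⟨Q, hQ, s, hs, hx, rfl⟩
    simp [measure_mono_null (inter_subset_left) h0]
  change sSup (mset n Ω E x) = 0
  rw [this]; simp

theorem maxFn_pos (n : ℕ) (Ω E : Set (En n)) (hb : IsBounded Ω) (hE : E ⊆ frontier Ω)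
    (hfin : μH[(n : ℝ) - 1] (frontier Ω) < ∞)
    (hne : (frontier Ω).Nonempty) (h0 : μH[(n : ℝ) - 1] E ≠ 0) (x : En n) :
    0 < maxFn n Ω E x := by
  obtain ⟨Q, hQ⟩ := hne
  obtain ⟨R, hR⟩ := (hb.closure.subset frontier_subset_closure : IsBounded (frontier Ω)).subset_ball Q
  set s := max R (dist x Q + 1) with hs
  have hsub : frontier Ω ⊆ ball Q s := hR.trans (ball_subset_ball (le_max_left _ _))
  have hs1 : dist x Q + 1 ≤ s := le_max_right _ _
  have hd : 0 ≤ dist x Q := dist_nonneg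
  have hmem : (μH[(n : ℝ) - 1] (E ∩ (ball Q s ∩ frontier Ω))).toReal /
      (μH[(n : ℝ) - 1] (ball Q s ∩ frontier Ω)).toReal ∈ mset n Ω E x :=
    ⟨Q, hQ, s, by linarith, by rw [mem_ball]; linarith, rfl⟩
  rw [inter_eq_right.2 hsub, inter_eq_left.2 hE] at hmem
  refine lt_of_lt_of_le ?_ (le_csSup ⟨1, fun w hw => mset_le n Ω E hfin x w hw⟩ hmem)
  have hEf : μH[(n : ℝ) - 1] E ≤ μH[(n : ℝ) - 1] (frontier Ω) := measure_mono hE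
  refine div_pos (ENNReal.toReal_pos h0 (hEf.trans_lt hfin).ne)
    (ENNReal.toReal_pos ?_ hfin.ne)
  intro h; exact h0 (le_antisymm (hEf.trans h.le) (zero_le))

theorem f_lsc (n : ℕ) (Ω E : Set (En n)) (hb : IsBounded Ω) (hE : E ⊆ frontier Ω)
    (hfin : μH[(n : ℝ) - 1] (frontier Ω) < ∞)
    (hne : (frontier Ω).Nonempty) (δ₀ : ℝ) (hδ₀ : 0 < δ₀) :
    LowerSemicontinuous (fun y => max 0 (1 + δ₀ * Real.log (maxFn n Ω E y))) := by
  by_cases h0 : μH[(n : ℝ) - 1] E = 0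
  · simp only [maxFn_zero n Ω E hne h0]
    exact lowerSemicontinuous_const
  intro x t ht
  have hp := maxFn_pos n Ω E hb hE hfin hne h0
  simp only [lt_max_iff] at ht ⊢
  rcases ht with h | h
  · exact Eventually.of_forall fun _ => Or.inl h
  · have h1 : (t - 1) / δ₀ < Real.log (maxFn n Ω E x) := by
      rw [div_lt_iff₀ hδ₀]; linarith
    rw [Real.lt_log_iff_exp_lt (hp x)] at h1
    filter_upwards [maxFn_lsc n Ω E hfin hne x _ h1] with y hy
    right
    rw [gt_iff_lt, ← Real.lt_log_iff_exp_lt (hp y), div_lt_iff₀ hδ₀] at hy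
    linarith

theorem f_le (n : ℕ) (Ω E : Set (En n)) (hb : IsBounded Ω) (hE : E ⊆ frontier Ω)
    (hfin : μH[(n : ℝ) - 1] (frontier Ω) < ∞)
    (hne : (frontier Ω).Nonempty) (δ₀ : ℝ) (hδ₀ : 0 < δ₀) (y : En n) :
    max 0 (1 + δ₀ * Real.log (maxFn n Ω E y)) ≤ 1 := by
  refine max_le zero_le_one ?_
  have : 0 ≤ maxFn n Ω E y := by
    by_cases h0 : μH[(n : ℝ) - 1] E = 0
    · exact (maxFn_zero n Ω E hne h0 y).ge
    · exact (maxFn_pos n Ω E hb hE hfin hne h0 y).le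
  have := Real.log_nonpos this (maxFn_le n Ω E hfin hne y)
  nlinarith

theorem moll_aux (n : ℕ) (Ω : Set (En n)) (φ : En n → ℝ) (hφ : Continuous φ)
    (hfin : μH[(n : ℝ) - 1] (frontier Ω) < ∞)
    (hpos : ∀ x ∈ frontier Ω, ∀ r > 0, 0 < μH[(n : ℝ) - 1] (ball x r ∩ frontier Ω))
    (hφ01 : ∀ z, φ z ∈ Icc (0 : ℝ) 1) (hφ1 : ∀ z ∈ ball (0 : En n) (1 / 2), φ z = 1)
    (hφsupp : Function.support φ ⊆ ball (0 : En n) 1)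
    (f : En n → ℝ) (hlsc : LowerSemicontinuous f) (hf0 : ∀ y, 0 ≤ f y) (hf1 : ∀ y, f y ≤ 1)
    (x : En n) (hx : x ∈ frontier Ω) :
    f x ≤ Filter.liminf (fun ε => mollify n Ω φ ε f x) (𝓝[>] (0 : ℝ)) := by
  haveI : IsFiniteMeasure (μH[(n : ℝ) - 1].restrict (frontier Ω)) :=
    ⟨by rw [Measure.restrict_apply_univ]; exact hfin⟩
  have hk0 : ∀ ε > 0, ∀ y, 0 ≤ (ε ^ (n - 1))⁻¹ * φ (ε⁻¹ • (x - y)) := fun ε hε y =>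
    mul_nonneg (by positivity) (hφ01 _).1
  have hkc : ∀ ε : ℝ, Continuous fun y => (ε ^ (n - 1))⁻¹ * φ (ε⁻¹ • (x - y)) := fun ε => by
    fun_prop
  have hki : ∀ ε > 0, Integrable (fun y => (ε ^ (n - 1))⁻¹ * φ (ε⁻¹ • (x - y)))
      (μH[(n : ℝ) - 1].restrict (frontier Ω)) := by
    intro ε hε
    refine Integrable.of_bound (hkc ε).aestronglyMeasurable ((ε ^ (n - 1))⁻¹) ?_
    refine Eventually.of_forall fun y => ?_
    rw [Real.norm_of_nonneg (hk0 ε hε y)]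
    exact mul_le_of_le_one_right (by positivity) (hφ01 _).2
  have hfi : ∀ ε > 0, Integrable (fun y => f y * ((ε ^ (n - 1))⁻¹ * φ (ε⁻¹ • (x - y))))
      (μH[(n : ℝ) - 1].restrict (frontier Ω)) := by
    intro ε hε
    refine (hki ε hε).bdd_mul (c := 1) hlsc.measurable.aestronglyMeasurable ?_
    refine Eventually.of_forall fun y => ?_
    rw [Real.norm_of_nonneg (hf0 y)]
    exact hf1 y
  have hden : ∀ ε > 0, 0 < ∫ y in frontier Ω, (ε ^ (n - 1))⁻¹ * φ (ε⁻¹ • (x - y))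
      ∂μH[(n : ℝ) - 1] := by
    intro ε hε
    rw [integral_pos_iff_support_of_nonneg (hk0 ε hε) (hki ε hε)]
    refine lt_of_lt_of_le (hpos x hx (ε / 2) (by positivity)) ?_
    rw [← Measure.restrict_apply measurableSet_ball]
    refine measure_mono fun y hy => ?_
    rw [Function.mem_support, hφ1]
    · positivity
    · rw [mem_ball_zero_iff, norm_smul, Real.norm_of_nonneg (by positivity), ← dist_eq_norm,
        dist_comm, inv_mul_lt_iff₀ hε]
      rw [mem_ball] at hy
      linarith
  have hle1 : ∀ ε > 0, mollify n Ω φ ε f x ≤ 1 := by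
    intro ε hε
    unfold mollify
    rw [div_le_one (hden ε hε)]
    refine integral_mono (hfi ε hε) (hki ε hε) fun y => ?_
    exact mul_le_of_le_one_left (hk0 ε hε y) (hf1 y)
  refine le_of_forall_lt fun c hc => ?_
  obtain ⟨c', hcc', hc'⟩ := exists_between hc
  refine hcc'.trans_le ?_
  have hev := hlsc x c' hc'
  obtain ⟨ρ, hρ, hball⟩ := Metric.eventually_nhds_iff.1 hev
  refine le_liminf_of_le ?_ ?_
  · refine IsBoundedUnder.isCoboundedUnder_ge ⟨1, ?_⟩
    rw [eventually_map]
    filter_upwards [self_mem_nhdsWithin] with ε hε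
    exact hle1 ε hε
  · filter_upwards [Ioo_mem_nhdsGT hρ] with ε hε
    unfold mollify
    rw [le_div_iff₀ (hden ε hε.1), ← integral_const_mul]
    refine integral_mono ((hki ε hε.1).const_mul c') (hfi ε hε.1) fun y => ?_
    by_cases hy : φ (ε⁻¹ • (x - y)) = 0
    · simp [hy]
    · have h1 := hφsupp hy
      rw [mem_ball_zero_iff, norm_smul, Real.norm_of_nonneg (inv_nonneg.2 hε.1.le),
        ← dist_eq_norm, dist_comm, inv_mul_lt_iff₀ hε.1, mul_one] at h1
      exact mul_le_mul_of_nonneg_right (hball (h1.trans hε.2)).le (hk0 ε hε.1 y)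


/-- for `f(x) = max{0, 1 + δ₀ log M_σχ_E(x)}`, one has
`f(x) ≤ liminf_{ε→0⁺} f_ε(x)` for every `x ∈ ∂Ω`. -/
theorem stmt16 (n : ℕ) (hn : 3 ≤ n) (C₁ C₂ : ℝ) (hC₁ : 0 < C₁) (hC₁₂ : C₁ ≤ C₂)
    (Ω : Set (En n)) (hΩ : IsOpen Ω) (hb : IsBounded Ω)
    (hA : AhlforsRegular n Ω C₁ C₂)
    (φ : En n → ℝ) (hφ : ContDiff ℝ (⊤ : ℕ∞) φ) (hφc : HasCompactSupport φ)
    (hφ01 : ∀ z, φ z ∈ Icc (0 : ℝ) 1) (hφ1 : ∀ z ∈ ball (0 : En n) (1 / 2), φ z = 1)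
    (hφsupp : Function.support φ ⊆ ball (0 : En n) 1)
    (E : Set (En n)) (hE : E ⊆ frontier Ω) (hEm : MeasurableSet E)
    (δ₀ : ℝ) (hδ₀ : 0 < δ₀) :
    ∀ x ∈ frontier Ω,
      max 0 (1 + δ₀ * Real.log (maxFn n Ω E x)) ≤
        Filter.liminf
          (fun ε => mollify n Ω φ ε
            (fun y => max 0 (1 + δ₀ * Real.log (maxFn n Ω E y))) x)
          (𝓝[>] (0 : ℝ)) := by
  intro x hx
  have hne : (frontier Ω).Nonempty := ⟨x, hx⟩
  have hfin := aux_fin n hn C₁ C₂ Ω hΩ hb hA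
  exact moll_aux n Ω φ hφ.continuous hfin (aux_pos n hn C₁ C₂ hC₁ Ω hΩ hb hA) hφ01 hφ1 hφsupp
    _ (f_lsc n Ω E hb hE hfin hne δ₀ hδ₀) (fun y => le_max_left _ _)
    (f_le n Ω E hb hE hfin hne δ₀ hδ₀) x hx
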